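/- Let a, b, c be positive real numbers and set x = (+,a), y = (−,b), z = (Λ,c) in H. Then both bracketings of the triple hyper-sum are singletons in the Λ-sector: (x⊞y)⊞z = {(Λ, c+|a−b|)} and x⊞(y⊞z) = {(Λ, a+b+c)}. Consequently the associativity defect (a+b+c) − (c+|a−b|) equals a+b−|a−b| = 2·min(a,b), is independent of c, and is strictly positive, so the two bracketings are distinct (and in fact disjoint) for all a, b, c > 0. -/

import Mathlib

inductive Sgn : Type
  | pos | neg | lam
deriving DecidableEq

inductive H : Type
  | zero : H
  | elt (σ : Sgn) (a : ℝ) (ha : 0 < a) : H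

noncomputable def hadd : H → H → Set H
  | H.zero, x => {x}
  | x, H.zero => {x}
  | H.elt Sgn.pos a _, H.elt Sgn.pos b _ =>
      {H.elt Sgn.pos (a + b) (by linarith)}
  | H.elt Sgn.neg a _, H.elt Sgn.neg b _ =>
      {H.elt Sgn.neg (a + b) (by linarith)}
  | H.elt Sgn.pos a _, H.elt Sgn.neg b _ =>
      if h : b < a then {H.elt Sgn.pos (a - b) (by linarith)}
      else if h' : a = b then {H.zero}
      else {H.elt Sgn.neg (b - a)
        (by push_neg at h; exact sub_pos.mpr (lt_of_le_of_ne h h'))}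
  | H.elt Sgn.neg b _, H.elt Sgn.pos a _ =>
      if h : b < a then {H.elt Sgn.pos (a - b) (by linarith)}
      else if h' : a = b then {H.zero}
      else {H.elt Sgn.neg (b - a)
        (by push_neg at h; exact sub_pos.mpr (lt_of_le_of_ne h h'))}
  | H.elt Sgn.pos a _, H.elt Sgn.lam b _ => {H.elt Sgn.lam (a + b) (by linarith)}
  | H.elt Sgn.neg a _, H.elt Sgn.lam b _ => {H.elt Sgn.lam (a + b) (by linarith)}
  | H.elt Sgn.lam b _, H.elt Sgn.pos a _ => {H.elt Sgn.lam (a + b) (by linarith)}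
  | H.elt Sgn.lam b _, H.elt Sgn.neg a _ => {H.elt Sgn.lam (a + b) (by linarith)}
  | H.elt Sgn.lam a _, H.elt Sgn.lam b _ =>
      if h : a = b then {H.elt Sgn.lam (2 * a) (by linarith), H.zero}
      else {H.elt Sgn.lam (a + b) (by linarith),
            H.elt Sgn.pos |a - b| (abs_pos.mpr (sub_ne_zero.mpr h)),
            H.elt Sgn.neg |a - b| (abs_pos.mpr (sub_ne_zero.mpr h))}

/-- Left bracketing `(x ⊞ y) ⊞ z` of the triple hyper-sum. -/
noncomputable def haddL (x y z : H) : Set H := ⋃ u ∈ hadd x y, hadd u z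

/-- Right bracketing `x ⊞ (y ⊞ z)` of the triple hyper-sum. -/
noncomputable def haddR (x y z : H) : Set H := ⋃ v ∈ hadd y z, hadd x v

theorem haddL_pos_neg_lam {a b c : ℝ} (ha : 0 < a) (hb : 0 < b) (hc : 0 < c) :
    haddL (H.elt Sgn.pos a ha) (H.elt Sgn.neg b hb) (H.elt Sgn.lam c hc)
      = {H.elt Sgn.lam (c + |a - b|) (by positivity)} := by
  rcases lt_trichotomy b a with h | rfl | h
  · simp [haddL, hadd, h, abs_of_pos (sub_pos.mpr h), add_comm]
  · simp [haddL, hadd]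
  · simp [haddL, hadd, h.not_gt, h.ne, abs_of_neg (sub_neg.mpr h), add_comm]

theorem haddR_pos_neg_lam {a b c : ℝ} (ha : 0 < a) (hb : 0 < b) (hc : 0 < c) :
    haddR (H.elt Sgn.pos a ha) (H.elt Sgn.neg b hb) (H.elt Sgn.lam c hc)
      = {H.elt Sgn.lam (a + b + c) (by linarith)} := by
  simp [haddR, hadd, add_assoc]

theorem add_sub_abs_sub_eq_two_mul_min (a b : ℝ) : a + b - |a - b| = 2 * min a b := by
  rw [min_def]
  split_ifs with h
  · rw [abs_of_nonpos (sub_nonpos.mpr h)]; ring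
  · rw [abs_of_pos (sub_pos.mpr (not_le.mp h))]; ring

theorem stmt_0 (a b c : ℝ) (ha : 0 < a) (hb : 0 < b) (hc : 0 < c) :
    haddL (H.elt Sgn.pos a ha) (H.elt Sgn.neg b hb) (H.elt Sgn.lam c hc)
      = {H.elt Sgn.lam (c + |a - b|) (by positivity)} ∧
    haddR (H.elt Sgn.pos a ha) (H.elt Sgn.neg b hb) (H.elt Sgn.lam c hc)
      = {H.elt Sgn.lam (a + b + c) (by linarith)} ∧
    (a + b + c) - (c + |a - b|) = a + b - |a - b| ∧
    a + b - |a - b| = 2 * min a b ∧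
    0 < (a + b + c) - (c + |a - b|) ∧
    Disjoint
      (haddL (H.elt Sgn.pos a ha) (H.elt Sgn.neg b hb) (H.elt Sgn.lam c hc))
      (haddR (H.elt Sgn.pos a ha) (H.elt Sgn.neg b hb) (H.elt Sgn.lam c hc)) := by
  have hmin := add_sub_abs_sub_eq_two_mul_min a b
  have hpos : 0 < min a b := lt_min ha hb
  refine ⟨haddL_pos_neg_lam ha hb hc, haddR_pos_neg_lam ha hb hc, by ring, hmin,
    by linarith, ?_⟩
  rw [haddL_pos_neg_lam, haddR_pos_neg_lam, Set.disjoint_singleton]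
  intro h
  injection h with _ h
  linarith
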